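/- Let p, k, r be positive integers and set m = p·k. Then, as an identity of integers, #APS(m, p, 2r+1) = #APS(p, p, 2r+1) + Σ_{i=0}^{r} C(2r+1, i) · p^i · (k^i − 1) · (−1)^{i+r}. -/

import Mathlib

open Finset

/-- `Prec p q` means the colored symbol `p = ξ^{p.1}(p.2)` precedes (is smaller than)
`q = ξ^{q.1}(q.2)`: `a > b`, or (`a = b` and `x > y`). -/
def Prec (p q : ℕ × ℕ) : Prop :=
  q.1 < p.1 ∨ (p.1 = q.1 ∧ q.2 < p.2)

instance : DecidableRel Prec := fun p q => by
  unfold Prec; infer_instance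

/-- `w : ℕ → ℕ × ℕ` (read on positions `1,…,n`) is an element of `Z_m ≀ S_n`:
each entry has color `< m` and norm in `{1,…,n}`, and the norms are pairwise distinct. -/
def IsGenPerm (m n : ℕ) (w : ℕ → ℕ × ℕ) : Prop :=
  (∀ i ∈ Finset.Icc 1 n, (w i).1 < m ∧ (w i).2 ∈ Finset.Icc 1 n) ∧
    Set.InjOn (fun i => (w i).2) (Set.Icc 1 n)

/-- The pinnacle set of the word `w`: values at interior positions `2 ≤ i ≤ n-1`
that strictly dominate both neighbors. -/
def pin (n : ℕ) (w : ℕ → ℕ × ℕ) : Finset (ℕ × ℕ) :=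
  ((Finset.Icc 2 (n - 1)).filter
      (fun i => Prec (w (i - 1)) (w i) ∧ Prec (w (i + 1)) (w i))).image w

/-- `P` is an admissible pinnacle set for `Z_m ≀ S_n`. -/
def IsAdmissible (m n : ℕ) (P : Finset (ℕ × ℕ)) : Prop :=
  ∃ w, IsGenPerm m n w ∧ pin n w = P

/-- `APS m n d` : admissible pinnacle sets for `Z_m ≀ S_n` of cardinality at most `d`. -/
def APS (m n d : ℕ) : Set (Finset (ℕ × ℕ)) :=
  {P | IsAdmissible m n P ∧ P.card ≤ d}

/-- The color sum `ε_w = e_1 + ⋯ + e_n` of a word `w`. -/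
def epsSum (n : ℕ) (w : ℕ → ℕ × ℕ) : ℕ :=
  ∑ i ∈ Finset.Icc 1 n, (w i).1

/-- `APSc m p n d` : sets `P` with `#P ≤ d` admitting a witness in the complex
reflection group `G(m,p,n) = {w ∈ Z_m ≀ S_n : ε_w ≡ 0 (mod p)}`. -/
def APSc (m p n d : ℕ) : Set (Finset (ℕ × ℕ)) :=
  {P | (∃ w, IsGenPerm m n w ∧ p ∣ epsSum n w ∧ pin n w = P) ∧ P.card ≤ d}

theorem exists_strictMonoOn_enum {α : Type*} [LinearOrder α] [Inhabited α] (s : Finset α) :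
    ∃ f : ℕ → α, StrictMonoOn f (Set.Iio #s) ∧ (Finset.range #s).image f = s := by
  refine ⟨fun i => if h : i < #s then s.orderEmbOfFin rfl ⟨i, h⟩ else default, ?_, ?_⟩
  · intro i hi j hj hij
    have hi : i < #s := hi
    have hj : j < #s := hj
    simpa [hi, hj] using hij
  · ext a
    constructor
    · intro h
      obtain ⟨i, hi, rfl⟩ := Finset.mem_image.1 h
      have hi : i < #s := Finset.mem_range.1 hi
      simp [hi, Finset.orderEmbOfFin_mem]
    · intro h
      have : a ∈ Set.range (s.orderEmbOfFin rfl) := by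
        rw [Finset.range_orderEmbOfFin]; exact h
      obtain ⟨i, rfl⟩ := this
      refine Finset.mem_image.2 ⟨i, by simp, by simp⟩

/-- If every element `q` of `P` has more elements of `V` below it than elements of `P` weakly
below it, then `P ∪ V` can be arranged in a word whose interior peaks are exactly `P`. -/
theorem exists_word_with_peaks {α : Type*} [LinearOrder α] [Inhabited α] {P V : Finset α} {n : ℕ}
    (hcard : #P + #V = n)
    (h : ∀ q ∈ P, #{x ∈ P | x ≤ q} + 1 ≤ #{v ∈ V | v < q}) :
    ∃ w : ℕ → α, (Finset.Icc 1 n).image w = P ∪ V ∧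
      ((Finset.Icc 2 (n - 1)).filter
        (fun i => w (i - 1) < w i ∧ w (i + 1) < w i)).image w = P := by
  obtain ⟨f, hf, hfP⟩ := exists_strictMonoOn_enum P
  obtain ⟨g, hg, hgV⟩ := exists_strictMonoOn_enum V
  have hfm : ∀ t < #P, f t ∈ P := fun t ht => by
    rw [← hfP]; exact Finset.mem_image_of_mem _ (by simpa using ht)
  have hgm : ∀ t < #V, g t ∈ V := fun t ht => by
    rw [← hgV]; exact Finset.mem_image_of_mem _ (by simpa using ht)
  have hgg : ∀ s t, s < t → t < #V → g s < g t := fun s t hst ht =>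
    hg (show s < #V by omega) ht hst
  have hcount : ∀ t < #P, t + 2 ≤ #{v ∈ V | v < f t} := by
    intro t ht
    have h1 : t + 1 ≤ #{x ∈ P | x ≤ f t} := by
      calc t + 1 = #((Finset.range (t + 1)).image f) := by
            rw [Finset.card_image_of_injOn, Finset.card_range]
            intro a ha b hb hab
            simp only [Finset.coe_range, Set.mem_Iio] at ha hb
            exact hf.injOn (show a < #P by omega) (show b < #P by omega) hab
        _ ≤ _ := by
            apply Finset.card_le_card
            intro x hx
            obtain ⟨i, hi, rfl⟩ := Finset.mem_image.1 hx
            have hi := Finset.mem_range.1 hi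
            exact Finset.mem_filter.2 ⟨hfm i (by omega),
              hf.monotoneOn (show i < #P by omega) (show t < #P from ht) (by omega)⟩
    have := h (f t) (hfm t ht)
    omega
  have hgf : ∀ t < #P, g (t + 1) < f t := by
    intro t ht
    by_contra hcon
    have hle : #{v ∈ V | v < f t} ≤ #((Finset.range (t + 1)).image g) := by
      apply Finset.card_le_card
      intro v hv
      obtain ⟨hv, hvt⟩ := Finset.mem_filter.1 hv
      rw [← hgV] at hv
      obtain ⟨i, hi, rfl⟩ := Finset.mem_image.1 hv
      have hi := Finset.mem_range.1 hi
      refine Finset.mem_image_of_mem _ (Finset.mem_range.2 ?_)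
      by_contra hit
      have := hg.monotoneOn (show t + 1 < #V by omega) (show i < #V from hi) (by omega)
      exact hcon (this.trans_lt hvt)
    have h2 := Finset.card_image_le (s := Finset.range (t + 1)) (f := g)
    have := hcount t ht
    simp only [Finset.card_range] at h2
    omega
  have hPV : #P = 0 ∨ #P + 1 ≤ #V := by
    rcases Nat.eq_zero_or_pos #P with h0 | h0
    · exact Or.inl h0
    · right
      have h1 := hcount (#P - 1) (by omega)
      have h2 := Finset.card_filter_le V (fun v => v < f (#P - 1))
      omega
  have hgf' : ∀ t < #P, g t < f t := fun t ht =>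
    (hgg t (t + 1) (by omega) (by omega)).trans (hgf t ht)
  let w : ℕ → α := fun i =>
    if i ≤ 2 * #P then (if i % 2 = 1 then g (i / 2) else f (i / 2 - 1)) else g (i - 1 - #P)
  have wodd : ∀ t ≤ #P, w (2 * t + 1) = g t := by
    intro t ht
    by_cases h' : 2 * t + 1 ≤ 2 * #P
    · simp only [w, if_pos h']
      rw [if_pos (by omega)]; congr 1; omega
    · simp only [w, if_neg h']; congr 1; omega
  have weven : ∀ t < #P, w (2 * t + 2) = f t := by
    intro t ht
    simp only [w]
    rw [if_pos (by omega), if_neg (by omega)]; congr 1; omega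
  have wtail : ∀ i, 2 * #P < i → w i = g (i - 1 - #P) := by
    intro i hi
    simp only [w]
    rw [if_neg (by omega)]
  refine ⟨w, ?_, ?_⟩
  · ext a
    simp only [Finset.mem_image, Finset.mem_Icc, Finset.mem_union]
    constructor
    · rintro ⟨i, hi, rfl⟩
      by_cases h1 : i ≤ 2 * #P
      · rcases Nat.even_or_odd' i with ⟨t, rfl | rfl⟩
        · left
          obtain ⟨u, rfl⟩ : ∃ u, t = u + 1 := ⟨t - 1, by omega⟩
          rw [show 2 * (u + 1) = 2 * u + 2 by ring, weven u (by omega)]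
          exact hfm u (by omega)
        · right
          rw [wodd t (by omega)]
          exact hgm t (by omega)
      · right
        rw [wtail i (by omega)]
        exact hgm _ (by omega)
    · rintro (ha | ha)
      · rw [← hfP] at ha
        obtain ⟨t, ht, rfl⟩ := Finset.mem_image.1 ha
        have ht := Finset.mem_range.1 ht
        exact ⟨2 * t + 2, by omega, weven t ht⟩
      · rw [← hgV] at ha
        obtain ⟨t, ht, rfl⟩ := Finset.mem_image.1 ha
        have ht := Finset.mem_range.1 ht
        by_cases h1 : t ≤ #P
        · exact ⟨2 * t + 1, by omega, wodd t h1⟩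
        · refine ⟨t + 1 + #P, by omega, ?_⟩
          rw [wtail _ (by omega)]; congr 1; omega
  · ext a
    simp only [Finset.mem_image, Finset.mem_filter, Finset.mem_Icc]
    constructor
    · rintro ⟨i, ⟨hi, hl, hr⟩, rfl⟩
      by_cases h1 : i ≤ 2 * #P
      · rcases Nat.even_or_odd' i with ⟨t, rfl | rfl⟩
        · obtain ⟨u, rfl⟩ : ∃ u, t = u + 1 := ⟨t - 1, by omega⟩
          rw [show 2 * (u + 1) = 2 * u + 2 by ring, weven u (by omega)]
          exact hfm u (by omega)
        · exfalso
          rw [wodd t (by omega), show 2 * t + 1 + 1 = 2 * t + 2 by ring,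
            weven t (by omega)] at hr
          exact absurd (hgf' t (by omega)) hr.not_gt
      · exfalso
        rw [wtail i (by omega), wtail (i + 1) (by omega)] at hr
        exact absurd (hgg (i - 1 - #P) (i + 1 - 1 - #P) (by omega) (by omega)) hr.not_gt
    · intro ha
      rw [← hfP] at ha
      obtain ⟨t, ht, rfl⟩ := Finset.mem_image.1 ha
      have ht := Finset.mem_range.1 ht
      refine ⟨2 * t + 2, ⟨by omega, ?_, ?_⟩, weven t ht⟩
      · rw [show 2 * t + 2 - 1 = 2 * t + 1 by omega, wodd t ht.le, weven t ht]
        exact hgf' t ht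
      · rw [show 2 * t + 2 + 1 = 2 * (t + 1) + 1 by omega, wodd (t + 1) ht, weven t ht]
        exact hgf t ht

theorem prec_iff_toLex_lt (a b : ℕ × ℕ) :
    Prec a b ↔ OrderDual.toDual (toLex a) < OrderDual.toDual (toLex b) := by
  rw [OrderDual.toDual_lt_toDual, Prod.Lex.toLex_lt_toLex]
  unfold Prec
  grind

theorem exists_genPerm_with_pin {m n : ℕ} {P V : Finset (ℕ × ℕ)}
    (hsub : P ∪ V ⊆ Finset.range m ×ˢ Finset.Icc 1 n) (hdisj : Disjoint P V)
    (hinj : Set.InjOn Prod.snd (↑(P ∪ V) : Set (ℕ × ℕ))) (hcard : #P + #V = n)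
    (h : ∀ q ∈ P, #{x ∈ P | ¬ Prec q x} + 1 ≤ #{v ∈ V | Prec v q}) :
    ∃ w, IsGenPerm m n w ∧ pin n w = P ∧ epsSum n w = ∑ a ∈ P ∪ V, a.1 := by
  let e : ℕ × ℕ ≃ (ℕ ×ₗ ℕ)ᵒᵈ := toLex.trans OrderDual.toDual
  have he : ∀ a b, Prec a b ↔ e a < e b := prec_iff_toLex_lt
  have key := exists_word_with_peaks (P := P.map e.toEmbedding) (V := V.map e.toEmbedding) (n := n)
    (by simpa using hcard) (by
      intro q hq
      obtain ⟨q, hqP, rfl⟩ := Finset.mem_map.1 hq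
      have := h q hqP
      simp only [he, not_lt] at this
      simpa [Finset.filter_map, Function.comp_def] using this)
  obtain ⟨w, hw, hpin⟩ := key
  have himg : (Finset.Icc 1 n).image (fun i => e.symm (w i)) = P ∪ V := by
    have := congrArg (Finset.image e.symm) hw
    simpa [Finset.image_image, Finset.image_union, Finset.map_eq_image, Function.comp_def]
      using this
  have hwinj : Set.InjOn (fun i => e.symm (w i)) (Finset.Icc 1 n : Finset ℕ) := by
    rw [← Finset.card_image_iff, himg, Finset.card_union_of_disjoint hdisj, hcard]
    simp
  refine ⟨fun i => e.symm (w i), ⟨?_, ?_⟩, ?_, ?_⟩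
  · intro i hi
    have : e.symm (w i) ∈ P ∪ V := himg ▸ Finset.mem_image_of_mem _ hi
    simpa using hsub this
  · rw [← Finset.coe_Icc]
    intro i hi j hj hij
    refine hwinj hi hj (hinj ?_ ?_ hij)
    · exact himg ▸ Finset.mem_image_of_mem _ hi
    · exact himg ▸ Finset.mem_image_of_mem _ hj
  · have := congrArg (Finset.image e.symm) hpin
    simpa [pin, he, Finset.image_image, Finset.map_eq_image, Function.comp_def] using this
  · rw [epsSum, ← himg, Finset.sum_image hwinj]

theorem IsGenPerm.injOn {m n : ℕ} {w : ℕ → ℕ × ℕ} (hw : IsGenPerm m n w) :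
    Set.InjOn w (Set.Icc 1 n) :=
  fun _ hi _ hj hij => hw.2 hi hj (congrArg Prod.snd hij)

theorem pin_subset_image (n : ℕ) (w : ℕ → ℕ × ℕ) : pin n w ⊆ (Finset.Icc 1 n).image w :=
  Finset.image_subset_image fun i hi => by
    simp only [Finset.mem_filter, Finset.mem_Icc] at hi ⊢
    omega

theorem IsGenPerm.image_subset {m n : ℕ} {w : ℕ → ℕ × ℕ} (hw : IsGenPerm m n w) :
    (Finset.Icc 1 n).image w ⊆ Finset.range m ×ˢ Finset.Icc 1 n :=
  Finset.image_subset_iff.2 fun i hi => by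
    have := hw.1 i hi
    simpa using this

theorem IsGenPerm.injOn_snd {m n : ℕ} {w : ℕ → ℕ × ℕ} (hw : IsGenPerm m n w) :
    Set.InjOn Prod.snd (↑((Finset.Icc 1 n).image w) : Set (ℕ × ℕ)) := by
  intro a ha b hb hab
  simp only [Finset.coe_image, Finset.coe_Icc, Set.mem_image] at ha hb
  obtain ⟨i, hi, rfl⟩ := ha
  obtain ⟨j, hj, rfl⟩ := hb
  rw [hw.2 hi hj hab]

/-- Each pinnacle `q` of a word dominates more non-pinnacles than there are pinnacles `⪯ q`. -/
theorem IsGenPerm.card_pin_lt {m n : ℕ} {w : ℕ → ℕ × ℕ} (hw : IsGenPerm m n w) {q : ℕ × ℕ}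
    (hq : q ∈ pin n w) :
    #{x ∈ pin n w | ¬ Prec q x} + 1 ≤ #{v ∈ (Finset.Icc 1 n).image w \ pin n w | Prec v q} := by
  set K := (Finset.Icc 2 (n - 1)).filter
      (fun i => (Prec (w (i - 1)) (w i) ∧ Prec (w (i + 1)) (w i)) ∧ ¬ Prec q (w i)) with hK
  have hKmem : ∀ i, i ∈ K ↔ (2 ≤ i ∧ i ≤ n - 1) ∧
      (Prec (w (i - 1)) (w i) ∧ Prec (w (i + 1)) (w i)) ∧ ¬ Prec q (w i) := by
    intro i; simp [hK]
  have hKne : K.Nonempty := by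
    obtain ⟨i, hi, rfl⟩ := Finset.mem_image.1 hq
    simp only [Finset.mem_filter, Finset.mem_Icc] at hi
    exact ⟨i, (hKmem i).2 ⟨hi.1, hi.2, by unfold Prec; omega⟩⟩
  have hnot : ∀ j, 1 ≤ j → j ≤ n →
      ((2 ≤ j ∧ Prec (w j) (w (j - 1))) ∨ Prec (w j) (w (j + 1))) → w j ∉ pin n w := by
    intro j hj1 hjn hlt hmem
    obtain ⟨i, hi, hij⟩ := Finset.mem_image.1 hmem
    simp only [Finset.mem_filter, Finset.mem_Icc] at hi
    have : i = j := hw.injOn ⟨by omega, by omega⟩ ⟨hj1, hjn⟩ hij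
    subst this
    obtain ⟨-, h1, h2⟩ := hi
    unfold Prec at *
    omega
  have hle : #{x ∈ pin n w | ¬ Prec q x} ≤ #K := by
    refine le_trans (Finset.card_le_card ?_) (Finset.card_image_le (s := K) (f := w))
    intro x hx
    obtain ⟨hx, hqx⟩ := Finset.mem_filter.1 hx
    obtain ⟨i, hi, rfl⟩ := Finset.mem_image.1 hx
    simp only [Finset.mem_filter, Finset.mem_Icc] at hi
    exact Finset.mem_image_of_mem _ ((hKmem i).2 ⟨hi.1, hi.2, hqx⟩)
  set L := insert (K.min' hKne - 1) (K.image (· + 1)) with hL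
  have hLcard : #L = #K + 1 := by
    rw [hL, Finset.card_insert_of_notMem, Finset.card_image_of_injective _ (add_left_injective 1)]
    intro hmem
    obtain ⟨i, hi, hieq⟩ := Finset.mem_image.1 hmem
    have := K.min'_le i hi
    have := hieq
    omega
  have hLprop : ∀ j ∈ L, (1 ≤ j ∧ j ≤ n) ∧ w j ∉ pin n w ∧ Prec (w j) q := by
    intro j hj
    rcases Finset.mem_insert.1 hj with rfl | hj
    · have := (hKmem _).1 (K.min'_mem hKne)
      set i := K.min' hKne
      have hi1 : i - 1 + 1 = i := by omega
      refine ⟨by omega, hnot _ (by omega) (by omega) (Or.inr (by rw [hi1]; exact this.2.1.1)), ?_⟩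
      obtain ⟨-, ⟨h1, -⟩, h2⟩ := this
      unfold Prec at *
      omega
    · obtain ⟨i, hi, rfl⟩ := Finset.mem_image.1 hj
      have := (hKmem _).1 hi
      refine ⟨by omega, hnot _ (by omega) (by omega)
        (Or.inl ⟨by omega, by simpa using this.2.1.2⟩), ?_⟩
      obtain ⟨-, ⟨-, h1⟩, h2⟩ := this
      unfold Prec at *
      omega
  have hLle : #L ≤ #{v ∈ (Finset.Icc 1 n).image w \ pin n w | Prec v q} := by
    have hLinj : Set.InjOn w L := fun i hi j hj hij =>
      hw.injOn (hLprop i hi).1 (hLprop j hj).1 hij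
    rw [← Finset.card_image_of_injOn hLinj]
    apply Finset.card_le_card
    intro x hx
    obtain ⟨j, hj, rfl⟩ := Finset.mem_image.1 hx
    obtain ⟨h1, h2, h3⟩ := hLprop j hj
    refine Finset.mem_filter.2 ⟨Finset.mem_sdiff.2 ⟨Finset.mem_image_of_mem _ ?_, h2⟩, h3⟩
    exact Finset.mem_Icc.2 h1
  omega

/-- The norms in `{1,…,n}` not used by `P`. -/
def freeNorms (n : ℕ) (P : Finset (ℕ × ℕ)) : Finset ℕ :=
  Finset.Icc 1 n \ P.image Prod.snd

/-- The numerical characterization of admissible pinnacle sets: every `q ∈ P` dominates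
sufficiently many unused norms when these are given the smallest symbols available. -/
def PinCond (m n : ℕ) (P : Finset (ℕ × ℕ)) : Prop :=
  P ⊆ Finset.range m ×ˢ Finset.Icc 1 n ∧ Set.InjOn Prod.snd (P : Set (ℕ × ℕ)) ∧
    ∀ q ∈ P, #{x ∈ P | ¬ Prec q x} + 1 ≤ #{x ∈ freeNorms n P | Prec (m - 1, x) q}

theorem card_freeNorms {m n : ℕ} {P : Finset (ℕ × ℕ)}
    (hsub : P ⊆ Finset.range m ×ˢ Finset.Icc 1 n) (hinj : Set.InjOn Prod.snd (P : Set (ℕ × ℕ))) :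
    #P + #(freeNorms n P) = n := by
  have hsub' : P.image Prod.snd ⊆ Finset.Icc 1 n := fun x hx => by
    obtain ⟨a, ha, rfl⟩ := Finset.mem_image.1 hx
    exact (Finset.mem_product.1 (hsub ha)).2
  have h1 := Finset.card_sdiff_add_card_eq_card hsub'
  rw [Finset.card_image_of_injOn hinj, Nat.card_Icc] at h1
  unfold freeNorms
  omega

theorem pinCond_of_isGenPerm {m n : ℕ} {w : ℕ → ℕ × ℕ} (hw : IsGenPerm m n w) :
    PinCond m n (pin n w) := by
  refine ⟨(pin_subset_image n w).trans hw.image_subset,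
    hw.injOn_snd.mono (by exact_mod_cast pin_subset_image n w), fun q hq => ?_⟩
  refine (hw.card_pin_lt hq).trans (Finset.card_le_card_of_injOn Prod.snd ?_ ?_)
  · intro v hv
    obtain ⟨hv, hvq⟩ := Finset.mem_filter.1 hv
    obtain ⟨hv, hvP⟩ := Finset.mem_sdiff.1 hv
    have hvm := Finset.mem_product.1 (hw.image_subset hv)
    refine Finset.mem_coe.2 (Finset.mem_filter.2 ⟨Finset.mem_sdiff.2 ⟨hvm.2, fun hmem => ?_⟩, ?_⟩)
    · obtain ⟨u, hu, huv⟩ := Finset.mem_image.1 hmem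
      have := hw.injOn_snd (Finset.mem_coe.2 (pin_subset_image n w hu)) (Finset.mem_coe.2 hv) huv
      exact hvP (this ▸ hu)
    · have := Finset.mem_range.1 hvm.1
      unfold Prec at *
      simp only
      omega
  · exact hw.injOn_snd.mono fun v hv => by
      have := (Finset.mem_filter.1 (Finset.mem_coe.1 hv)).1
      exact Finset.mem_coe.2 (Finset.mem_sdiff.1 this).1

theorem exists_genPerm_of_coloring {m n : ℕ} {P : Finset (ℕ × ℕ)} {col : ℕ → ℕ}
    (hsub : P ⊆ Finset.range m ×ˢ Finset.Icc 1 n) (hinj : Set.InjOn Prod.snd (P : Set (ℕ × ℕ)))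
    (hcol : ∀ x, col x < m)
    (h : ∀ q ∈ P, #{x ∈ P | ¬ Prec q x} + 1 ≤ #{x ∈ freeNorms n P | Prec (col x, x) q}) :
    ∃ w, IsGenPerm m n w ∧ pin n w = P ∧
      epsSum n w = ∑ a ∈ P, a.1 + ∑ x ∈ freeNorms n P, col x := by
  have hcinj : Function.Injective (fun x => (col x, x)) := fun x y hxy => congrArg Prod.snd hxy
  set V := (freeNorms n P).image (fun x => (col x, x)) with hV
  have hVmem : ∀ v ∈ V, v.2 ∈ freeNorms n P ∧ v.1 = col v.2 := by
    intro v hv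
    obtain ⟨x, hx, rfl⟩ := Finset.mem_image.1 hv
    exact ⟨hx, rfl⟩
  have hne : ∀ a ∈ P, ∀ v ∈ V, a.2 ≠ v.2 := by
    intro a ha v hv hav
    exact (Finset.mem_sdiff.1 (hVmem v hv).1).2 (hav ▸ Finset.mem_image_of_mem _ ha)
  have hdisj : Disjoint P V := by
    rw [Finset.disjoint_left]
    exact fun a ha hav => hne a ha a hav rfl
  obtain ⟨w, hw, hpin, hsum⟩ := exists_genPerm_with_pin (m := m) (n := n) (P := P) (V := V)
    (by
      refine Finset.union_subset hsub fun v hv => Finset.mem_product.2 ⟨?_, ?_⟩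
      · rw [(hVmem v hv).2]; exact Finset.mem_range.2 (hcol _)
      · exact (Finset.mem_sdiff.1 (hVmem v hv).1).1)
    hdisj
    (by
      intro a ha b hb hab
      rcases Finset.mem_union.1 (Finset.mem_coe.1 ha) with ha | ha <;>
        rcases Finset.mem_union.1 (Finset.mem_coe.1 hb) with hb | hb
      · exact hinj ha hb hab
      · exact absurd hab (hne a ha b hb)
      · exact absurd hab.symm (hne b hb a ha)
      · exact Prod.ext (by rw [(hVmem a ha).2, (hVmem b hb).2, hab]) hab)
    (by
      rw [hV, Finset.card_image_of_injective _ hcinj]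
      exact card_freeNorms hsub hinj)
    (by
      intro q hq
      rw [hV, Finset.filter_image, Finset.card_image_of_injective _ hcinj]
      exact h q hq)
  refine ⟨w, hw, hpin, ?_⟩
  rw [hsum, Finset.sum_union hdisj, hV, Finset.sum_image hcinj.injOn]

theorem mem_APS_iff {m n d : ℕ} (hm : 1 ≤ m) {P : Finset (ℕ × ℕ)} :
    P ∈ APS m n d ↔ PinCond m n P ∧ #P ≤ d := by
  refine and_congr_left fun _ => ⟨?_, ?_⟩
  · rintro ⟨w, hw, rfl⟩
    exact pinCond_of_isGenPerm hw
  · rintro ⟨h1, h2, h3⟩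
    obtain ⟨w, hw, hpin, -⟩ :=
      exists_genPerm_of_coloring (col := fun _ => m - 1) h1 h2 (fun _ => by omega) h3
    exact ⟨w, hw, hpin⟩

theorem APSc_subset_APS (m p n d : ℕ) : APSc m p n d ⊆ APS m n d :=
  fun _ ⟨⟨w, hw, _, hpin⟩, hcard⟩ => ⟨⟨w, hw, hpin⟩, hcard⟩

theorem finite_APS (m n d : ℕ) : (APS m n d).Finite := by
  refine Set.Finite.subset (Finset.range m ×ˢ Finset.Icc 1 n).powerset.finite_toSet ?_
  rintro P ⟨⟨w, hw, rfl⟩, -⟩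
  exact Finset.mem_coe.2 (Finset.mem_powerset.2 (pinCond_of_isGenPerm hw).1)

theorem exists_lt_dvd_add {p : ℕ} (hp : 1 ≤ p) (S : ℕ) : ∃ t < p, p ∣ S + t := by
  refine ⟨(p - S % p) % p, Nat.mod_lt _ hp, ?_⟩
  rw [Nat.dvd_iff_mod_eq_zero, Nat.add_mod, Nat.mod_mod, ← Nat.add_mod, Nat.add_mod]
  have := Nat.mod_lt S hp
  rw [← Nat.add_mod, Nat.add_mod_eq_ite]
  rcases Nat.eq_zero_or_pos (S % p) with h | h
  · simp [h]
  · rw [Nat.mod_eq_of_lt (show p - S % p < p by omega)]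
    simp [show S % p + (p - S % p) = p by omega]

/-- An admissible set has a witness with color sum divisible by `p` unless it has maximal size
and all its colors are among the `p` largest ones. -/
theorem mem_APSc_of_mem_APS {p k r : ℕ} (hp : 1 ≤ p) (hk : 1 ≤ k) {P : Finset (ℕ × ℕ)}
    (hP : P ∈ APS (p * k) (2 * r + 1) r)
    (h : #P < r ∨ ∃ a ∈ P, a.1 < p * (k - 1)) : P ∈ APSc (p * k) p (2 * r + 1) r := by
  have hmk : p * k = p * (k - 1) + p := by
    obtain ⟨l, rfl⟩ : ∃ l, k = l + 1 := ⟨k - 1, by omega⟩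
    simp [Nat.mul_succ]
  obtain ⟨⟨hsub, hinj, hcond⟩, hcard⟩ := (mem_APS_iff (by omega)).1 hP
  have hfree := card_freeNorms hsub hinj
  have hne : (freeNorms (2 * r + 1) P).Nonempty := Finset.card_pos.1 (by omega)
  set F := freeNorms (2 * r + 1) P
  set z := F.min' hne with hz
  have hzF : z ∈ F := F.min'_mem hne
  obtain ⟨t, htp, htd⟩ := exists_lt_dvd_add hp
    (∑ a ∈ P, a.1 + ∑ x ∈ F.erase z, (p * k - 1) + p * (k - 1))
  set c := p * (k - 1) + t with hc
  obtain ⟨w, hw, hpin, hsum⟩ := exists_genPerm_of_coloring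
    (col := fun x => if x = z then c else p * k - 1) hsub hinj
    (fun x => by split_ifs <;> omega) (by
      intro q hq
      change _ ≤ #{x ∈ F | Prec (if x = z then c else p * k - 1, x) q}
      have hq' := hcond q hq
      by_cases hzq : Prec (p * k - 1, z) q ∧ ¬ Prec (c, z) q
      · have h1 : F.erase z ⊆
            {x ∈ F | Prec (if x = z then c else p * k - 1, x) q} := by
          intro x hx
          obtain ⟨hxz, hxF⟩ := Finset.mem_erase.1 hx
          have hzx : z ≤ x := F.min'_le x hxF
          refine Finset.mem_filter.2 ⟨hxF, ?_⟩
          rw [if_neg hxz]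
          unfold Prec at *
          omega
        have h2 := Finset.card_le_card h1
        rw [Finset.card_erase_of_mem hzF] at h2
        have h3 := Finset.card_filter_le P (fun x => ¬ Prec q x)
        rcases h with h | ⟨a, ha, hac⟩
        · omega
        · have h4 : {x ∈ P | ¬ Prec q x} ⊆ P.erase a := by
            intro x hx
            obtain ⟨hxP, hqx⟩ := Finset.mem_filter.1 hx
            refine Finset.mem_erase.2 ⟨?_, hxP⟩
            rintro rfl
            unfold Prec at *
            dsimp only at *
            omega
          have h5 := Finset.card_le_card h4
          rw [Finset.card_erase_of_mem ha] at h5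
          have := Finset.card_pos.2 ⟨a, ha⟩
          omega
      · refine hq'.trans (Finset.card_le_card ?_)
        intro x hx
        obtain ⟨hxF, hxq⟩ := Finset.mem_filter.1 hx
        refine Finset.mem_filter.2 ⟨hxF, ?_⟩
        split_ifs with hxz
        · subst hxz; by_contra hcon; exact hzq ⟨hxq, hcon⟩
        · exact hxq)
  refine ⟨⟨w, hw, ?_, hpin⟩, hcard⟩
  rw [hsum, ← Finset.add_sum_erase _ _ hzF]
  have : ∑ x ∈ F.erase z, (if x = z then c else p * k - 1) = ∑ x ∈ F.erase z, (p * k - 1) :=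
    Finset.sum_congr rfl fun x hx => if_neg (Finset.ne_of_mem_erase hx)
  rw [this, if_pos rfl, hc]
  convert htd using 1
  ring

/-- Translation of colors by `s`. -/
def colorShift (s : ℕ) : ℕ × ℕ ↪ ℕ × ℕ :=
  ⟨fun a => (a.1 + s, a.2), fun a b h => by
    simp only [Prod.mk.injEq, add_left_inj] at h
    exact Prod.ext h.1 h.2⟩

theorem colorShift_apply (s : ℕ) (a : ℕ × ℕ) : colorShift s a = (a.1 + s, a.2) := rfl

theorem prec_colorShift {s : ℕ} {a b : ℕ × ℕ} :
    Prec (colorShift s a) (colorShift s b) ↔ Prec a b := by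
  simp [colorShift_apply, Prec]

theorem pin_colorShift (s n : ℕ) (w : ℕ → ℕ × ℕ) :
    pin n (fun i => colorShift s (w i)) = (pin n w).map (colorShift s) := by
  simp [pin, prec_colorShift, Finset.map_eq_image, Finset.image_image, Function.comp_def]

theorem epsSum_colorShift (s n : ℕ) (w : ℕ → ℕ × ℕ) :
    epsSum n (fun i => colorShift s (w i)) = epsSum n w + n * s := by
  simp [epsSum, colorShift_apply, Finset.sum_add_distrib]

theorem isGenPerm_colorShift {m s n : ℕ} {w : ℕ → ℕ × ℕ} :
    IsGenPerm (m + s) n (fun i => colorShift s (w i)) ↔ IsGenPerm m n w := by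
  simp [IsGenPerm, colorShift_apply]

/-- In a word of length `2r+1` with `r` pinnacles, no color is below all pinnacle colors. -/
theorem IsGenPerm.le_color_of_card_pin {m r s : ℕ} {w : ℕ → ℕ × ℕ} (hr : 1 ≤ r)
    (hw : IsGenPerm m (2 * r + 1) w) (hcard : #(pin (2 * r + 1) w) = r)
    (hs : ∀ a ∈ pin (2 * r + 1) w, s ≤ a.1) {i : ℕ} (hi : i ∈ Finset.Icc 1 (2 * r + 1)) :
    s ≤ (w i).1 := by
  set P := pin (2 * r + 1) w with hP
  by_cases hiP : w i ∈ P
  · exact hs _ hiP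
  have hPne : P.Nonempty := Finset.card_pos.1 (by omega)
  obtain ⟨q, hq, hqmax⟩ := Finset.exists_max_image P
    (fun a => OrderDual.toDual (toLex a)) hPne
  have hall : {x ∈ P | ¬ Prec q x} = P := by
    refine Finset.filter_true_of_mem fun x hx => ?_
    rw [prec_iff_toLex_lt]
    exact not_lt.2 (hqmax x hx)
  have h1 := hw.card_pin_lt hq
  rw [← hP, hall, hcard] at h1
  have h2 : #((Finset.Icc 1 (2 * r + 1)).image w \ P) = r + 1 := by
    rw [Finset.card_sdiff_of_subset (pin_subset_image _ _), hcard,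
      Finset.card_image_of_injOn (by simpa using hw.injOn), Nat.card_Icc]
    omega
  have h3 := Finset.eq_of_subset_of_card_le (Finset.filter_subset (fun v => Prec v q)
    ((Finset.Icc 1 (2 * r + 1)).image w \ P)) (by omega)
  have h4 : w i ∈ (Finset.Icc 1 (2 * r + 1)).image w \ P :=
    Finset.mem_sdiff.2 ⟨Finset.mem_image_of_mem _ hi, hiP⟩
  rw [← h3] at h4
  have h5 := (Finset.mem_filter.1 h4).2
  have := hs q hq
  unfold Prec at h5
  omega

theorem exists_eq_colorShift {n s : ℕ} {w : ℕ → ℕ × ℕ} (hs : ∀ i ∈ Finset.Icc 1 n, s ≤ (w i).1) :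
    ∃ w' : ℕ → ℕ × ℕ, ∀ i ∈ Finset.Icc 1 n, w i = colorShift s (w' i) :=
  ⟨fun i => ((w i).1 - s, (w i).2), fun i hi => by
    have := hs i hi
    exact Prod.ext (by simp [colorShift_apply, this]) rfl⟩

theorem pin_congr {n : ℕ} {w w' : ℕ → ℕ × ℕ} (h : ∀ i ∈ Finset.Icc 1 n, w i = w' i) :
    pin n w = pin n w' := by
  unfold pin
  have hmem : ∀ i, 1 ≤ i → i ≤ n → w i = w' i := fun i h1 h2 => h i (Finset.mem_Icc.2 ⟨h1, h2⟩)
  rw [Finset.filter_congr (q := fun i => Prec (w' (i - 1)) (w' i) ∧ Prec (w' (i + 1)) (w' i))]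
  · refine Finset.image_congr fun i hi => ?_
    have hi := Finset.mem_Icc.1 (Finset.mem_filter.1 (Finset.mem_coe.1 hi)).1
    exact hmem i (by omega) (by omega)
  · intro i hi
    have hi := Finset.mem_Icc.1 hi
    rw [hmem i (by omega) (by omega), hmem (i - 1) (by omega) (by omega),
      hmem (i + 1) (by omega) (by omega)]

theorem isGenPerm_congr {m n : ℕ} {w w' : ℕ → ℕ × ℕ} (h : ∀ i ∈ Finset.Icc 1 n, w i = w' i)
    (hw : IsGenPerm m n w) : IsGenPerm m n w' := by
  refine ⟨fun i hi => h i hi ▸ hw.1 i hi, hw.2.congr fun i hi => ?_⟩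
  have hi' := h i (Finset.mem_Icc.2 hi)
  simp only [hi']

theorem epsSum_congr {n : ℕ} {w w' : ℕ → ℕ × ℕ} (h : ∀ i ∈ Finset.Icc 1 n, w i = w' i) :
    epsSum n w = epsSum n w' :=
  Finset.sum_congr rfl fun i hi => by rw [h i hi]

theorem exists_word_map_colorShift_iff {m p s r : ℕ} (hr : 1 ≤ r) (hps : p ∣ s)
    {P : Finset (ℕ × ℕ)} (hcard : #P = r) :
    (∃ w, IsGenPerm (m + s) (2 * r + 1) w ∧ p ∣ epsSum (2 * r + 1) w ∧
        pin (2 * r + 1) w = P.map (colorShift s)) ↔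
      ∃ w, IsGenPerm m (2 * r + 1) w ∧ p ∣ epsSum (2 * r + 1) w ∧ pin (2 * r + 1) w = P := by
  constructor
  · rintro ⟨w, hw, hdvd, hpin⟩
    have hs : ∀ i ∈ Finset.Icc 1 (2 * r + 1), s ≤ (w i).1 := fun i hi => by
      refine hw.le_color_of_card_pin hr (by rw [hpin, Finset.card_map, hcard]) ?_ hi
      rw [hpin]
      intro a ha
      obtain ⟨b, -, rfl⟩ := Finset.mem_map.1 ha
      simp [colorShift_apply]
    obtain ⟨w', hw'⟩ := exists_eq_colorShift hs
    refine ⟨w', isGenPerm_colorShift.1 (isGenPerm_congr hw' hw), ?_, ?_⟩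
    · rw [epsSum_congr hw', epsSum_colorShift] at hdvd
      exact (Nat.dvd_add_left (hps.mul_left _)).1 hdvd
    · rw [pin_congr hw', pin_colorShift] at hpin
      exact Finset.map_injective _ hpin
  · rintro ⟨w, hw, hdvd, rfl⟩
    refine ⟨fun i => colorShift s (w i), isGenPerm_colorShift.2 hw, ?_, pin_colorShift _ _ _⟩
    rw [epsSum_colorShift]
    exact dvd_add hdvd (hps.mul_left _)

theorem APSc_one (m n d : ℕ) : APSc m 1 n d = APS m n d := by
  simp [APSc, APS, IsAdmissible]

theorem mem_APSc_map_colorShift_iff {m p s r : ℕ} (hr : 1 ≤ r) (hps : p ∣ s)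
    {P : Finset (ℕ × ℕ)} (hcard : #P = r) :
    P.map (colorShift s) ∈ APSc (m + s) p (2 * r + 1) r ↔ P ∈ APSc m p (2 * r + 1) r := by
  simp only [APSc, Set.mem_ofPred_eq, Finset.card_map]
  rw [exists_word_map_colorShift_iff hr hps hcard]

theorem ncard_APS_diff_APSc {p k r : ℕ} (hp : 1 ≤ p) (hk : 1 ≤ k) (hr : 1 ≤ r) :
    (APS (p * k) (2 * r + 1) r \ APSc (p * k) p (2 * r + 1) r).ncard =
      (APS p (2 * r + 1) r \ APSc p p (2 * r + 1) r).ncard := by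
  have hmk : p * k = p + p * (k - 1) := by
    obtain ⟨l, rfl⟩ : ∃ l, k = l + 1 := ⟨k - 1, by omega⟩
    simp [Nat.mul_succ, add_comm]
  have hmaps : ∀ P : Finset (ℕ × ℕ), #P = r →
      (P.map (colorShift (p * (k - 1))) ∈
        APS (p * k) (2 * r + 1) r \ APSc (p * k) p (2 * r + 1) r ↔
        P ∈ APS p (2 * r + 1) r \ APSc p p (2 * r + 1) r) := by
    intro P hP
    rw [Set.mem_sdiff, Set.mem_sdiff, ← APSc_one, ← APSc_one, hmk,
      mem_APSc_map_colorShift_iff hr (one_dvd _) hP,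
      mem_APSc_map_colorShift_iff hr (Dvd.intro _ rfl) hP]
  have himage : APS (p * k) (2 * r + 1) r \ APSc (p * k) p (2 * r + 1) r =
      Set.image (Finset.map (colorShift (p * (k - 1))))
        (APS p (2 * r + 1) r \ APSc p p (2 * r + 1) r) := by
    ext Q
    constructor
    · rintro hQ
      have hnot : ¬ (#Q < r ∨ ∃ a ∈ Q, a.1 < p * (k - 1)) := fun h =>
        hQ.2 (mem_APSc_of_mem_APS hp hk hQ.1 h)
      push Not at hnot
      have hcard : #Q = r := le_antisymm hQ.1.2 hnot.1
      have hQeq : (Q.image fun a => (a.1 - p * (k - 1), a.2)).map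
          (colorShift (p * (k - 1))) = Q := by
        rw [Finset.map_eq_image, Finset.image_image]
        conv_rhs => rw [← Finset.image_id (s := Q)]
        refine Finset.image_congr fun a ha => Prod.ext ?_ rfl
        have := hnot.2 a ha
        simp [colorShift_apply, this]
      refine ⟨_, (hmaps _ ?_).1 (hQeq.symm ▸ hQ), hQeq⟩
      rw [← hcard, ← Finset.card_map (colorShift (p * (k - 1))), hQeq]
    · rintro ⟨P, hP, rfl⟩
      refine (hmaps P ?_).2 hP
      refine le_antisymm hP.1.2 (not_lt.1 fun hlt => hP.2 ?_)
      have := mem_APSc_of_mem_APS (k := 1) hp le_rfl (by simpa using hP.1) (Or.inl hlt)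
      simpa using this
  rw [himage, Set.ncard_image_of_injective _ (Finset.map_injective _)]

/-- Sets of symbols with colors `< m` and pairwise distinct norms in `X`. -/
def coloredSets (m : ℕ) (X : Finset ℕ) : Finset (Finset (ℕ × ℕ)) :=
  {P ∈ (Finset.range m ×ˢ X).powerset | ∀ a ∈ P, ∀ b ∈ P, a.2 = b.2 → a = b}

theorem mem_coloredSets {m : ℕ} {X : Finset ℕ} {P : Finset (ℕ × ℕ)} :
    P ∈ coloredSets m X ↔
      (∀ a ∈ P, a.1 < m ∧ a.2 ∈ X) ∧ ∀ a ∈ P, ∀ b ∈ P, a.2 = b.2 → a = b := by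
  simp [coloredSets, Finset.subset_iff]

theorem coloredSets_empty (m : ℕ) : coloredSets m ∅ = {∅} := by
  ext P
  rw [mem_coloredSets, Finset.mem_singleton]
  constructor
  · intro h
    exact Finset.eq_empty_of_forall_notMem fun a ha => by simpa using h.1 a ha
  · rintro rfl
    simp

theorem notMem_of_mem_coloredSets {m a : ℕ} {X : Finset ℕ} (ha : a ∉ X) {P : Finset (ℕ × ℕ)}
    (hP : P ∈ coloredSets m X) (c : ℕ) : (c, a) ∉ P :=
  fun h => ha ((mem_coloredSets.1 hP).1 _ h).2

theorem coloredSets_insert {m a : ℕ} {X : Finset ℕ} (ha : a ∉ X) :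
    coloredSets m (insert a X) = coloredSets m X ∪
      (Finset.range m ×ˢ coloredSets m X).image (fun y => insert (y.1, a) y.2) := by
  ext P
  simp only [Finset.mem_union, Finset.mem_image, Finset.mem_product, Finset.mem_range,
    mem_coloredSets]
  constructor
  · rintro ⟨h1, h2⟩
    by_cases hc : ∃ c, (c, a) ∈ P
    · obtain ⟨c, hc⟩ := hc
      refine Or.inr ⟨(c, P.erase (c, a)), ⟨(h1 _ hc).1, fun b hb => ?_, fun b hb d hd => ?_⟩,
        Finset.insert_erase hc⟩
      · obtain ⟨hne, hb⟩ := Finset.mem_erase.1 hb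
        refine ⟨(h1 b hb).1, (Finset.mem_insert.1 (h1 b hb).2).resolve_left fun hba => hne ?_⟩
        exact h2 b hb _ hc hba
      · exact h2 b (Finset.mem_of_mem_erase hb) d (Finset.mem_of_mem_erase hd)
    · refine Or.inl ⟨fun b hb => ⟨(h1 b hb).1, ?_⟩, h2⟩
      refine (Finset.mem_insert.1 (h1 b hb).2).resolve_left fun hba => hc ⟨b.1, ?_⟩
      rw [← hba]
      exact hb
  · rintro (⟨h1, h2⟩ | ⟨⟨c, Q⟩, ⟨hc, h1, h2⟩, rfl⟩)
    · exact ⟨fun b hb => ⟨(h1 b hb).1, Finset.mem_insert_of_mem (h1 b hb).2⟩, h2⟩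
    · simp only at hc h1 h2
      refine ⟨fun b hb => ?_, fun b hb d hd hbd => ?_⟩
      · rcases Finset.mem_insert.1 hb with rfl | hb
        · exact ⟨hc, Finset.mem_insert_self _ _⟩
        · exact ⟨(h1 b hb).1, Finset.mem_insert_of_mem (h1 b hb).2⟩
      · rcases Finset.mem_insert.1 hb with rfl | hb <;> rcases Finset.mem_insert.1 hd with rfl | hd
        · rfl
        · exact absurd (show a ∈ X from (show a = d.2 from hbd) ▸ (h1 d hd).2) ha
        · exact absurd (show a ∈ X from (show b.2 = a from hbd) ▸ (h1 b hb).2) ha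
        · exact h2 b hb d hd hbd

theorem card_filter_coloredSets_insert {m a : ℕ} {X : Finset ℕ} (ha : a ∉ X)
    (φ : Finset (ℕ × ℕ) → Prop) [DecidablePred φ] :
    #{P ∈ coloredSets m (insert a X) | φ P} = #{P ∈ coloredSets m X | φ P} +
      ∑ c ∈ Finset.range m, #{P ∈ coloredSets m X | φ (insert (c, a) P)} := by
  have hdisj : Disjoint (coloredSets m X)
      ((Finset.range m ×ˢ coloredSets m X).image (fun y => insert (y.1, a) y.2)) := by
    rw [Finset.disjoint_right]
    intro P hP hPX
    obtain ⟨y, -, rfl⟩ := Finset.mem_image.1 hP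
    exact notMem_of_mem_coloredSets ha hPX y.1 (Finset.mem_insert_self _ _)
  have hinj : Set.InjOn (fun y : ℕ × Finset (ℕ × ℕ) => insert (y.1, a) y.2)
      (↑(Finset.range m ×ˢ coloredSets m X) : Set (ℕ × Finset (ℕ × ℕ))) := by
    rintro ⟨c, P⟩ hP ⟨d, Q⟩ hQ h
    have hcP := notMem_of_mem_coloredSets ha (Finset.mem_product.1 (Finset.mem_coe.1 hP)).2
    have hcQ := notMem_of_mem_coloredSets ha (Finset.mem_product.1 (Finset.mem_coe.1 hQ)).2
    simp only at h hcP hcQ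
    have hcd : c = d := by
      have : (c, a) ∈ insert (d, a) Q := h ▸ Finset.mem_insert_self _ _
      rcases Finset.mem_insert.1 this with h' | h'
      · exact congrArg Prod.fst h'
      · exact absurd h' (hcQ c)
    subst hcd
    rw [← Finset.erase_insert (hcP c), h, Finset.erase_insert (hcQ c)]
  simp only [Finset.card_filter]
  rw [coloredSets_insert ha, Finset.sum_union hdisj, Finset.sum_image hinj, Finset.sum_product]

/-- The ballot condition on the symbols of color `M` in `P`. -/
def Ballot (M : ℕ) (X : Finset ℕ) (P : Finset (ℕ × ℕ)) : Prop :=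
  ∀ q ∈ P, q.1 = M →
    #{x ∈ P | x.1 = M ∧ q.2 ≤ x.2} + 1 ≤ #{x ∈ X \ P.image Prod.snd | q.2 < x}

instance (M : ℕ) (X : Finset ℕ) : DecidablePred (Ballot M X) := fun P => by
  unfold Ballot; infer_instance

theorem ballot_insert_norm {m M a : ℕ} {X : Finset ℕ} (ha : ∀ x ∈ X, a < x)
    {P : Finset (ℕ × ℕ)} (hP : P ∈ coloredSets m X) :
    Ballot M (insert a X) P ↔ Ballot M X P := by
  refine forall₂_congr fun q hq => imp_congr_right fun _ => ?_
  have hq2 := ha _ ((mem_coloredSets.1 hP).1 q hq).2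
  have : {x ∈ insert a X \ P.image Prod.snd | q.2 < x} =
      {x ∈ X \ P.image Prod.snd | q.2 < x} := by
    ext x
    simp only [Finset.mem_filter, Finset.mem_sdiff, Finset.mem_insert]
    constructor
    · rintro ⟨⟨rfl | h, h'⟩, h''⟩
      · omega
      · exact ⟨⟨h, h'⟩, h''⟩
    · rintro ⟨⟨h, h'⟩, h''⟩
      exact ⟨⟨Or.inr h, h'⟩, h''⟩
  rw [this]

theorem ballot_insert {m M a c : ℕ} {X : Finset ℕ} (ha : ∀ x ∈ X, a < x)
    {P : Finset (ℕ × ℕ)} (hP : P ∈ coloredSets m X) :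
    Ballot M (insert a X) (insert (c, a) P) ↔ Ballot M X P ∧
      (c = M → #{x ∈ P | x.1 = M} + 2 ≤ #(X \ P.image Prod.snd)) := by
  have haX : a ∉ X := fun h => lt_irrefl a (ha a h)
  have hmem := (mem_coloredSets.1 hP).1
  have hsd : insert a X \ (insert (c, a) P).image Prod.snd = X \ P.image Prod.snd := by
    rw [Finset.image_insert]
    ext x
    simp only [Finset.mem_sdiff, Finset.mem_insert]
    constructor
    · tauto
    · rintro ⟨h, h'⟩
      refine ⟨Or.inr h, fun hx => ?_⟩
      rcases hx with rfl | hx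
      · exact haX h
      · exact h' hx
  unfold Ballot
  rw [hsd, Finset.forall_mem_insert, and_comm]
  refine and_congr ?_ ?_
  · refine forall₂_congr fun q hq => imp_congr_right fun _ => ?_
    have hq2 := ha _ (hmem q hq).2
    rw [Finset.filter_insert, if_neg (by simp only; omega)]
  · refine imp_congr_right fun hc => ?_
    subst hc
    have h1 : {x ∈ insert (c, a) P | x.1 = c ∧ a ≤ x.2} = insert (c, a) {x ∈ P | x.1 = c} := by
      rw [Finset.filter_insert, if_pos (by simp)]
      congr 1
      refine Finset.filter_congr fun x hx => ?_
      have := ha _ (hmem x hx).2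
      simp only [and_iff_left_iff_imp]
      omega
    have h2 : {x ∈ X \ P.image Prod.snd | a < x} = X \ P.image Prod.snd :=
      Finset.filter_true_of_mem fun x hx => ha x (Finset.mem_sdiff.1 hx).1
    rw [h1, h2, Finset.card_insert_of_notMem fun h =>
      notMem_of_mem_coloredSets haX hP c (Finset.mem_filter.1 h).1]

/-- Ballot sets with exactly `j` symbols of color `≠ M` and at most `s` of color `M`. -/
def ballotSets (M : ℕ) (X : Finset ℕ) (j s : ℕ) : Finset (Finset (ℕ × ℕ)) :=
  {P ∈ coloredSets (M + 1) X |
    Ballot M X P ∧ #{x ∈ P | x.1 ≠ M} = j ∧ #{x ∈ P | x.1 = M} ≤ s}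

theorem card_sdiff_of_mem_coloredSets {m : ℕ} {X : Finset ℕ} {P : Finset (ℕ × ℕ)}
    (hP : P ∈ coloredSets m X) : #(X \ P.image Prod.snd) + #P = #X := by
  obtain ⟨h1, h2⟩ := mem_coloredSets.1 hP
  have hsub : P.image Prod.snd ⊆ X := Finset.image_subset_iff.2 fun a ha => (h1 a ha).2
  rw [← Finset.card_sdiff_add_card_eq_card hsub,
    Finset.card_image_of_injOn fun a ha b hb => h2 a ha b hb]

theorem card_eq_add_card_color (M : ℕ) (P : Finset (ℕ × ℕ)) :
    #{x ∈ P | x.1 ≠ M} + #{x ∈ P | x.1 = M} = #P := by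
  rw [add_comm]
  exact Finset.card_filter_add_card_filter_not (s := P) (fun x => x.1 = M)

theorem card_ballotSets_insert (M a : ℕ) {X : Finset ℕ} (ha : ∀ x ∈ X, a < x) (j s : ℕ)
    (hs : s = 0 ∨ 2 * s ≤ #X - j) :
    #(ballotSets M (insert a X) j s) = #(ballotSets M X j s) +
      (if j = 0 then 0 else M * #(ballotSets M X (j - 1) s)) +
      (if s = 0 then 0 else #(ballotSets M X j (s - 1))) := by
  have haX : a ∉ X := fun h => lt_irrefl a (ha a h)
  unfold ballotSets
  rw [card_filter_coloredSets_insert haX, Finset.sum_range_succ, ← add_assoc]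
  congr 1
  · congr 1
    · congr 1
      refine Finset.filter_congr fun P hP => ?_
      rw [ballot_insert_norm ha hP]
    · have hstat : ∀ c ∈ Finset.range M, ∀ P ∈ coloredSets (M + 1) X,
          ((Ballot M (insert a X) (insert (c, a) P) ∧
            #{x ∈ insert (c, a) P | x.1 ≠ M} = j ∧ #{x ∈ insert (c, a) P | x.1 = M} ≤ s) ↔
          (Ballot M X P ∧ #{x ∈ P | x.1 ≠ M} + 1 = j ∧ #{x ∈ P | x.1 = M} ≤ s)) := by
        intro c hc P hP
        have hcM : c ≠ M := (Finset.mem_range.1 hc).ne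
        rw [ballot_insert ha hP, Finset.filter_insert, Finset.filter_insert, if_pos hcM,
          if_neg hcM, Finset.card_insert_of_notMem fun h =>
            notMem_of_mem_coloredSets haX hP c (Finset.mem_filter.1 h).1]
        simp [hcM]
      rw [Finset.sum_congr rfl fun c hc =>
        congrArg Finset.card (Finset.filter_congr (hstat c hc))]
      rw [Finset.sum_const, Finset.card_range, smul_eq_mul]
      split_ifs with hj
      · rw [Finset.card_eq_zero.2 (Finset.filter_eq_empty_iff.2 fun P _ => by omega), mul_zero]
      · congr 2
        refine Finset.filter_congr fun P _ => ?_
        have : #{x ∈ P | x.1 ≠ M} + 1 = j ↔ #{x ∈ P | x.1 ≠ M} = j - 1 := by omega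
        rw [this]
  · have hstat : ∀ P ∈ coloredSets (M + 1) X,
        ((Ballot M (insert a X) (insert (M, a) P) ∧
          #{x ∈ insert (M, a) P | x.1 ≠ M} = j ∧ #{x ∈ insert (M, a) P | x.1 = M} ≤ s) ↔
        (Ballot M X P ∧ #{x ∈ P | x.1 ≠ M} = j ∧ #{x ∈ P | x.1 = M} + 1 ≤ s)) := by
      intro P hP
      rw [ballot_insert ha hP, Finset.filter_insert, Finset.filter_insert, if_pos rfl,
        if_neg (by simp), Finset.card_insert_of_notMem fun h =>
          notMem_of_mem_coloredSets haX hP M (Finset.mem_filter.1 h).1]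
      have h1 := card_sdiff_of_mem_coloredSets hP
      have h2 := card_eq_add_card_color M P
      constructor
      · tauto
      · rintro ⟨h3, h4, h5⟩
        exact ⟨⟨h3, fun _ => by omega⟩, h4, h5⟩
    rw [Finset.filter_congr hstat]
    split_ifs with hs0
    · exact Finset.card_eq_zero.2 (Finset.filter_eq_empty_iff.2 fun P _ => by omega)
    · congr 1
      refine Finset.filter_congr fun P _ => ?_
      have : #{x ∈ P | x.1 = M} + 1 ≤ s ↔ #{x ∈ P | x.1 = M} ≤ s - 1 := by omega
      rw [this]

theorem Ballot.two_mul_card_lt {m M : ℕ} {X : Finset ℕ} {P : Finset (ℕ × ℕ)}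
    (hP : P ∈ coloredSets m X) (h : Ballot M X P) (hpos : 0 < #{x ∈ P | x.1 = M}) :
    2 * #{x ∈ P | x.1 = M} + 1 + #{x ∈ P | x.1 ≠ M} ≤ #X := by
  obtain ⟨q, hq, hqmin⟩ := Finset.exists_min_image {x ∈ P | x.1 = M} Prod.snd
    (Finset.card_pos.1 hpos)
  obtain ⟨hqP, hqM⟩ := Finset.mem_filter.1 hq
  have h1 := h q hqP hqM
  have h2 : {x ∈ P | x.1 = M ∧ q.2 ≤ x.2} = {x ∈ P | x.1 = M} :=
    Finset.filter_congr fun x hx =>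
      and_iff_left_of_imp fun hxM => hqmin x (Finset.mem_filter.2 ⟨hx, hxM⟩)
  rw [h2] at h1
  have h3 := Finset.card_filter_le (X \ P.image Prod.snd) (fun x => q.2 < x)
  have h4 := card_sdiff_of_mem_coloredSets hP
  have h5 := card_eq_add_card_color M P
  omega

theorem card_ballotSets (M : ℕ) (X : Finset ℕ) (j s : ℕ) (hs : 2 * s ≤ #X - j) :
    #(ballotSets M X j s) = (#X).choose j * M ^ j * (#X - j - 1).choose s := by
  induction X using Finset.induction_on_min generalizing j s with
  | empty =>
    obtain rfl : s = 0 := by simpa using hs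
    rcases j with - | j
    · rw [ballotSets, coloredSets_empty, Finset.filter_true_of_mem (by simp [Ballot])]
      simp
    · rw [ballotSets, coloredSets_empty, Finset.filter_false_of_mem (by simp)]
      simp
  | insert a X ha ih =>
    have haX : a ∉ X := fun h => lt_irrefl a (ha a h)
    rw [Finset.card_insert_of_notMem haX] at hs ⊢
    have hstrict : ∀ s, s = 0 ∨ 2 * s ≤ #X - j → #(ballotSets M (insert a X) j s) =
        (#X + 1).choose j * M ^ j * (#X + 1 - j - 1).choose s := by
      intro s hs
      rw [card_ballotSets_insert M a ha j s hs, ih j s (by omega)]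
      have hj : (if j = 0 then 0 else M * #(ballotSets M X (j - 1) s)) =
          (if j = 0 then 0 else M * ((#X).choose (j - 1) * M ^ (j - 1) *
            (#X - (j - 1) - 1).choose s)) := by
        split_ifs
        · rfl
        · rw [ih (j - 1) s (by omega)]
      have hs' : (if s = 0 then 0 else #(ballotSets M X j (s - 1))) =
          (if s = 0 then 0 else (#X).choose j * M ^ j * (#X - j - 1).choose (s - 1)) := by
        split_ifs
        · rfl
        · rw [ih j (s - 1) (by omega)]
      rw [hj, hs']
      rcases s with - | s
      · rcases j with - | j
        · simp
        · simp [Nat.choose_succ_succ]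
          ring
      · obtain ⟨u, hu⟩ : ∃ u, #X = j + u + 1 := ⟨#X - j - 1, by omega⟩
        rw [hu]
        rcases j with - | j
        · simp [Nat.choose_succ_succ]
          ring
        · have e1 : j + 1 + u + 1 - (j + 1) - 1 = u := by omega
          have e2 : j + 1 + u + 1 - (j + 1 - 1) - 1 = u + 1 := by omega
          have e3 : j + 1 + u + 1 + 1 - (j + 1) - 1 = u + 1 := by omega
          rw [e1, e2, e3, if_neg (by omega), if_neg (by omega),
            Nat.choose_succ_succ' (j + 1 + u + 1) j, Nat.choose_succ_succ' u s]
          simp only [Nat.add_sub_cancel]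
          ring
    by_cases hlt : s = 0 ∨ 2 * s ≤ #X - j
    · exact hstrict s hlt
    · obtain ⟨t, rfl⟩ : ∃ t, s = t + 1 := ⟨s - 1, by omega⟩
      have heq : ballotSets M (insert a X) j (t + 1) = ballotSets M (insert a X) j t := by
        refine Finset.filter_congr fun P hP => ?_
        refine and_congr_right fun hB => and_congr_right fun hj => ⟨fun h => ?_, by omega⟩
        by_contra hcon
        have := hB.two_mul_card_lt hP (by omega)
        rw [Finset.card_insert_of_notMem haX] at this
        omega
      rw [heq, hstrict t (by omega)]
      congr 1
      rw [show #X + 1 - j - 1 = 2 * t + 1 by omega]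
      exact (Nat.choose_symm_half t).symm

theorem mem_APS_iff_ballot {M r : ℕ} {P : Finset (ℕ × ℕ)} :
    P ∈ APS (M + 1) (2 * r + 1) r ↔
      P ∈ coloredSets (M + 1) (Finset.Icc 1 (2 * r + 1)) ∧
        Ballot M (Finset.Icc 1 (2 * r + 1)) P ∧ #P ≤ r := by
  rw [mem_APS_iff (by omega), PinCond]
  have hcol : P ∈ coloredSets (M + 1) (Finset.Icc 1 (2 * r + 1)) ↔
      P ⊆ Finset.range (M + 1) ×ˢ Finset.Icc 1 (2 * r + 1) ∧
        Set.InjOn Prod.snd (P : Set (ℕ × ℕ)) := by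
    rw [coloredSets, Finset.mem_filter, Finset.mem_powerset]
    exact and_congr_right fun _ => ⟨fun h a ha b hb => h a ha b hb, fun h a ha b hb => h ha hb⟩
  rw [← and_assoc, ← hcol, and_assoc]
  refine and_congr_right fun hP => and_congr_left fun hcard => ?_
  have hmem := (mem_coloredSets.1 hP).1
  have hcount := card_sdiff_of_mem_coloredSets hP
  rw [Nat.card_Icc] at hcount
  refine forall₂_congr fun q hq => ?_
  have hqM := (hmem q hq).1
  by_cases hqeq : q.1 = M
  · have h1 : {x ∈ P | ¬ Prec q x} = {x ∈ P | x.1 = M ∧ q.2 ≤ x.2} :=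
      Finset.filter_congr fun x hx => by
        have := (hmem x hx).1
        unfold Prec
        omega
    have h2 : ∀ x, Prec (M + 1 - 1, x) q ↔ q.2 < x := fun x => by
      unfold Prec
      simp only
      omega
    rw [h1]
    simp only [h2, hqeq, forall_const, freeNorms]
  · have h1 : {x ∈ freeNorms (2 * r + 1) P | Prec (M + 1 - 1, x) q} = freeNorms (2 * r + 1) P :=
      Finset.filter_true_of_mem fun x _ => by
        unfold Prec
        simp only
        omega
    have h2 := Finset.card_filter_le P (fun x => ¬ Prec q x)
    rw [h1, freeNorms]
    simp only [hqeq, false_imp_iff, iff_true]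
    omega

theorem ncard_APS (M r : ℕ) :
    (APS (M + 1) (2 * r + 1) r).ncard =
      ∑ j ∈ Finset.range (r + 1), (2 * r + 1).choose j * M ^ j * (2 * r - j).choose (r - j) := by
  have hset : APS (M + 1) (2 * r + 1) r =
      ↑{P ∈ coloredSets (M + 1) (Finset.Icc 1 (2 * r + 1)) |
        Ballot M (Finset.Icc 1 (2 * r + 1)) P ∧ #P ≤ r} := by
    ext P
    rw [mem_APS_iff_ballot, Finset.mem_coe, Finset.mem_filter]
  rw [hset, Set.ncard_coe_finset, Finset.card_eq_sum_card_fiberwise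
    (f := fun P => #{x ∈ P | x.1 ≠ M}) (t := Finset.range (r + 1))]
  · refine Finset.sum_congr rfl fun j hj => ?_
    have hj := Finset.mem_range.1 hj
    have := card_ballotSets M (Finset.Icc 1 (2 * r + 1)) j (r - j)
      (by rw [Nat.card_Icc]; omega)
    rw [Nat.card_Icc, show 2 * r + 1 + 1 - 1 = 2 * r + 1 by omega,
      show 2 * r + 1 - j - 1 = 2 * r - j by omega] at this
    rw [← this, ballotSets, Finset.filter_filter]
    congr 1
    refine Finset.filter_congr fun P _ => ?_
    have := card_eq_add_card_color M P
    constructor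
    · rintro ⟨⟨h1, h2⟩, h3⟩
      exact ⟨h1, h3, by omega⟩
    · rintro ⟨h1, h2, h3⟩
      exact ⟨⟨h1, by omega⟩, h2⟩
  · intro P hP
    have h1 := (Finset.mem_filter.1 (Finset.mem_coe.1 hP)).2.2
    have h2 := card_eq_add_card_color M P
    simp only [Finset.coe_range, Set.mem_Iio]
    omega

theorem ncard_APS_eq_alternating_sum {m r : ℕ} (hm : 1 ≤ m) :
    ((APS m (2 * r + 1) r).ncard : ℤ) =
      ∑ i ∈ Finset.range (r + 1), ((2 * r + 1).choose i : ℤ) * (m : ℤ) ^ i * (-1) ^ (i + r) := by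
  obtain ⟨M, rfl⟩ : ∃ M, m = M + 1 := ⟨m - 1, by omega⟩
  rw [ncard_APS]
  push_cast
  have hexp : ∀ i ∈ Finset.range (r + 1),
      ((2 * r + 1).choose i : ℤ) * ((M : ℤ) + 1) ^ i * (-1) ^ (i + r) =
      ∑ j ∈ Finset.range (r + 1),
        ((2 * r + 1).choose i * i.choose j : ℤ) * (M : ℤ) ^ j * (-1) ^ (i + r) := by
    intro i hi
    have hi := Finset.mem_range.1 hi
    rw [add_pow, Finset.sum_subset (s₂ := Finset.range (r + 1))
      (Finset.range_subset_range.2 (by omega))]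
    · rw [Finset.mul_sum, Finset.sum_mul]
      refine Finset.sum_congr rfl fun j _ => ?_
      ring
    · intro j _ hj
      rw [Nat.choose_eq_zero_of_lt (by simpa using hj)]
      simp
  rw [Finset.sum_congr rfl hexp, Finset.sum_comm]
  refine Finset.sum_congr rfl fun j hj => ?_
  have hj : j ≤ r := by simpa [Nat.lt_succ_iff] using hj
  obtain ⟨s, rfl⟩ : ∃ s, r = j + s := ⟨r - j, by omega⟩
  rw [show j + s + 1 = j + (s + 1) by ring, Finset.sum_range_add]
  rw [Finset.sum_eq_zero fun i hi => by
    rw [Nat.choose_eq_zero_of_lt (Finset.mem_range.1 hi)]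
    simp, zero_add]
  have halt := Int.alternating_sum_range_choose_eq_choose (n := j + 2 * s) (m := s)
  rw [show 2 * (j + s) - j = j + 2 * s by omega, show j + s - j = s by omega]
  have hterm : ∀ l ∈ Finset.range (s + 1),
      ((2 * (j + s) + 1).choose (j + l) * (j + l).choose j : ℤ) * (M : ℤ) ^ j *
        (-1) ^ (j + l + (j + s)) =
      ((2 * (j + s) + 1).choose j : ℤ) * (M : ℤ) ^ j * (-1) ^ s *
        ((-1) ^ l * ((j + 2 * s + 1).choose l : ℤ)) := by
    intro l hl
    have hl := Finset.mem_range.1 hl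
    have h := Nat.choose_mul (n := 2 * (j + s) + 1) (k := j + l) (s := j) (by omega)
    rw [show 2 * (j + s) + 1 - j = j + 2 * s + 1 by omega, show j + l - j = l by omega] at h
    have h' : ((2 * (j + s) + 1).choose (j + l) * (j + l).choose j : ℤ) =
        (2 * (j + s) + 1).choose j * (j + 2 * s + 1).choose l := by exact_mod_cast h
    rw [h', show j + l + (j + s) = 2 * j + (s + l) by ring, pow_add, pow_mul, pow_add]
    norm_num
    ring
  rw [Finset.sum_congr rfl hterm, ← Finset.mul_sum, halt]
  have : ((-1 : ℤ) ^ s) * (-1) ^ s = 1 := by rw [← mul_pow]; norm_num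
  linear_combination (-((2 * (j + s) + 1).choose j * (M : ℤ) ^ j * (j + 2 * s).choose s : ℤ)) * this

/-- `#APS(pk, p, 2r+1) = #APS(p, p, 2r+1) + Σ_{i=0}^{r} C(2r+1,i) pⁱ (kⁱ-1) (-1)^{i+r}`. -/
theorem APSc_odd_reduction (p k r : ℕ) (hp : 1 ≤ p) (hk : 1 ≤ k) (hr : 1 ≤ r) :
    ((APSc (p * k) p (2 * r + 1) r).ncard : ℤ) =
      ((APSc p p (2 * r + 1) r).ncard : ℤ) +
        ∑ i ∈ Finset.range (r + 1),
          (Nat.choose (2 * r + 1) i : ℤ) * (p : ℤ) ^ i * ((k : ℤ) ^ i - 1) *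
            (-1) ^ (i + r) := by
  have hm : 1 ≤ p * k := Nat.mul_pos hp hk
  have hsplit : ∀ m, ((APS m (2 * r + 1) r).ncard : ℤ) =
      (APSc m p (2 * r + 1) r).ncard +
        (APS m (2 * r + 1) r \ APSc m p (2 * r + 1) r).ncard := fun m => by
    have := Set.ncard_sdiff_add_ncard_of_subset (APSc_subset_APS m p (2 * r + 1) r)
      (finite_APS m (2 * r + 1) r)
    rw [← this]
    push_cast
    ring
  have h1 := hsplit (p * k)
  have h2 := hsplit p
  rw [ncard_APS_diff_APSc hp hk hr, ncard_APS_eq_alternating_sum hm] at h1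
  rw [ncard_APS_eq_alternating_sum hp] at h2
  have hsum : ∑ i ∈ Finset.range (r + 1),
      (Nat.choose (2 * r + 1) i : ℤ) * (p : ℤ) ^ i * ((k : ℤ) ^ i - 1) * (-1) ^ (i + r) =
      ∑ i ∈ Finset.range (r + 1),
        ((2 * r + 1).choose i : ℤ) * ((p * k : ℕ) : ℤ) ^ i * (-1) ^ (i + r) -
      ∑ i ∈ Finset.range (r + 1),
        ((2 * r + 1).choose i : ℤ) * (p : ℤ) ^ i * (-1) ^ (i + r) := by
    rw [← Finset.sum_sub_distrib]
    refine Finset.sum_congr rfl fun i _ => ?_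
    push_cast
    ring
  rw [hsum]
  linarith
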